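/- arXiv:1803.10370 — 2 statements merged into one kernel-verified Lean document; each statement's English description precedes it below -/
import Mathlib

section
/- Let μ be a Borel probability measure on a compact interval 𝕀 ⊂ ℝ of positive length, and n ∈ ℕ. For every x ∈ Ξ_n there exists a best Kolmogorov-distance approximation of μ given x, i.e. p* ∈ Π_n minimizing p ↦ d_K(μ, δ_x^p). Moreover, d_K(μ, δ_x^p) = min_{q∈Π_n} d_K(μ, δ_x^q) if and only if for every j = 0,…,n with x_j < x_{j+1}: F_{μ−}(x_{j+1}) − K•(x) ≤ P_j ≤ F_μ(x_j) + K•(x); and in this case d_K(μ, δ_x^p) = K•(x). -/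
open MeasureTheory Filter Set

noncomputable section

namespace BenfordApprox

/-- Right-hand limit `f₊` of a nondecreasing `f : ℝ → ℝ̄`, at an extended-real point. -/
def fplus (f : ℝ → EReal) (a : EReal) : EReal := sInf (f '' {x : ℝ | a < (x : EReal)})

/-- Left-hand limit `f₋` of a nondecreasing `f : ℝ → ℝ̄`, at an extended-real point. -/
def fminus (f : ℝ → EReal) (a : EReal) : EReal := sSup (f '' {x : ℝ | (x : EReal) < a})

/-- The (upper) inverse function `f⁻¹(t) = sup {x : f x ≤ t}` (with `sup ∅ = ⊥`). -/
def upperInv (f : ℝ → EReal) (t : ℝ) : EReal :=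
  sSup ((fun x : ℝ => (x : EReal)) '' {x : ℝ | f x ≤ (t : EReal)})

/-- The upper inverse, for an extended-real argument. -/
def upperInvE (f : ℝ → EReal) (t : EReal) : EReal :=
  sSup ((fun x : ℝ => (x : EReal)) '' {x : ℝ | f x ≤ t})

/-- Lévy-type distance `d_L(f,g)` between nondecreasing functions `f g : ℝ → ℝ̄`. -/
def dLfun (f g : ℝ → EReal) : EReal :=
  sInf ((fun y : ℝ => (y : EReal)) ''
    {y : ℝ | 0 ≤ y ∧ ∀ x : ℝ, f (x - y) - (y : EReal) ≤ g x ∧ g x ≤ f (x + y) + (y : EReal)})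

/-- The auxiliary function `ℓ_{f,I}`; it depends on `I` only through `lo = inf I`, `hi = sup I`. -/
def ell (f : ℝ → EReal) (lo hi : EReal) (x : ℝ) : ℝ :=
  sInf {y : ℝ | 0 ≤ y ∧ fminus f (hi - (y : EReal)) - (y : EReal) ≤ (x : EReal) ∧
    (x : EReal) ≤ fplus f (lo + (y : EReal)) + (y : EReal)}

/-- The minimal value `ℓ*_{f,I} = min {y ≥ 0 : f₋(sup I − y) − y ≤ f₊(inf I + y) + y}`. -/
def ellStar (f : ℝ → EReal) (lo hi : EReal) : ℝ :=
  sInf {y : ℝ | 0 ≤ y ∧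
    fminus f (hi - (y : EReal)) - (y : EReal) ≤ fplus f (lo + (y : EReal)) + (y : EReal)}

/-- Distribution function `F_μ(t) = μ {y ∈ 𝕀 : y ≤ t}` of `μ`, where `𝕀 = [A,B]`. -/
def cdf (μ : Measure ℝ) (A B : ℝ) (t : ℝ) : ℝ := (μ (Icc A B ∩ Iic t)).toReal

/-- `F_μ` evaluated at an extended-real point (so `F_μ(−∞) = 0`, `F_μ(+∞) = 1`). -/
def cdfE (μ : Measure ℝ) (A B : ℝ) (a : EReal) : ℝ :=
  (μ (Icc A B ∩ {y : ℝ | (y : EReal) ≤ a})).toReal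

/-- Left limit `F_{μ−}` at an extended-real point (so `F_{μ−}(−∞) = 0`, `F_{μ−}(+∞) = 1`). -/
def cdfL (μ : Measure ℝ) (A B : ℝ) (a : EReal) : ℝ :=
  sSup ((cdf μ A B) '' {t : ℝ | (t : EReal) < a})

/-- Left limit `F_{μ−}` at a real point. -/
def cdfm (μ : Measure ℝ) (A B : ℝ) (t : ℝ) : ℝ := sSup ((cdf μ A B) '' Iio t)

/-- The (upper) quantile function `F_μ⁻¹` of `μ` on `𝕀 = [A,B]`, extended monotonically to `ℝ`. -/
def quant (μ : Measure ℝ) (A B : ℝ) (t : ℝ) : ℝ :=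
  if t < (μ {A}).toReal ∨ t < 0 then A
  else sSup {y ∈ Icc A B | cdf μ A B y ≤ t}

/-- Left limit `F⁻¹_{μ−}` of the quantile function. -/
def quantm (μ : Measure ℝ) (A B : ℝ) (t : ℝ) : ℝ := sSup ((quant μ A B) '' Iio t)

/-- `F_μ` as a function into the extended reals. -/
def cdfEReal (μ : Measure ℝ) (A B : ℝ) : ℝ → EReal := fun t => ((cdf μ A B t : ℝ) : EReal)

/-- `F_μ⁻¹` as a function into the extended reals. -/
def quantEReal (μ : Measure ℝ) (A B : ℝ) : ℝ → EReal := fun t => ((quant μ A B t : ℝ) : EReal)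

/-- The finitely supported measure `δ_x^p = Σ_j p_j δ_{x_j}`. -/
def discr (n : ℕ) (x p : Fin n → ℝ) : Measure ℝ :=
  ∑ j : Fin n, ENNReal.ofReal (p j) • Measure.dirac (x j)

/-- `p ∈ Π_n`: a probability vector. -/
def IsPi (n : ℕ) (p : Fin n → ℝ) : Prop := (∀ j, 0 ≤ p j) ∧ ∑ j, p j = 1

/-- `x ∈ Ξ_n`: a nondecreasing vector of locations in `𝕀 = [A,B]`. -/
def IsXi (A B : ℝ) (n : ℕ) (x : Fin n → ℝ) : Prop := (∀ j, x j ∈ Icc A B) ∧ Monotone x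

/-- The uniform weight vector `u_n = (1/n, …, 1/n)`. -/
def unif (n : ℕ) : Fin n → ℝ := fun _ => 1 / (n : ℝ)

/-- Partial sums `P_i = Σ_{j<i} p_j` (so `P_0 = 0`, `P_n = 1`). -/
def psum (n : ℕ) (p : Fin n → ℝ) (i : ℕ) : ℝ := ∑ j : Fin n, if (j : ℕ) < i then p j else 0

/-- Locations extended by `x_0 = −∞`, `x_{n+1} = +∞`; here `extPts n x j` is the paper's `x_j`. -/
def extPts (n : ℕ) (x : Fin n → ℝ) : ℕ → EReal := fun j =>
  if hj : j = 0 then ⊥ else if h : j ≤ n then ((x ⟨j - 1, by omega⟩ : ℝ) : EReal) else ⊤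

/-- `xcoord n x j` is the paper's `x_{j+1}` (0-based access). -/
def xcoord (n : ℕ) (x : Fin n → ℝ) (j : ℕ) : ℝ := if h : j < n then x ⟨j, h⟩ else 0

/-- The normalizing constant `ω = max{1, λ(𝕀)}/λ(𝕀)` for `𝕀 = [A,B]`. -/
def omegaI (A B : ℝ) : ℝ := max 1 (B - A) / (B - A)

/-- Lévy distance between Borel measures on `𝕀 = [A,B]`. -/
def dLevy (A B : ℝ) (μ ν : Measure ℝ) : ℝ :=
  omegaI A B * sInf {y : ℝ | 0 ≤ y ∧
    ∀ t : ℝ, cdf μ A B (t - y) - y ≤ cdf ν A B t ∧ cdf ν A B t ≤ cdf μ A B (t + y) + y}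

/-- Kolmogorov (uniform) distance between Borel measures on `𝕀 = [A,B]`. -/
def dKol (A B : ℝ) (μ ν : Measure ℝ) : ℝ :=
  sSup (Set.range fun t : ℝ => |cdf μ A B t - cdf ν A B t|)

/-- `L¹`-Kantorovich distance between Borel measures on `𝕀 = [A,B]`. -/
def dKant1 (A B : ℝ) (μ ν : Measure ℝ) : ℝ :=
  (B - A)⁻¹ * ∫ y in Ioo (0 : ℝ) 1, |quant μ A B y - quant ν A B y|

/-- `L^r`-Kantorovich distance between Borel measures on `𝕀 = [A,B]`. -/
def dKant (A B r : ℝ) (μ ν : Measure ℝ) : ℝ :=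
  (B - A)⁻¹ * (∫ y in Ioo (0 : ℝ) 1, |quant μ A B y - quant ν A B y| ^ r) ^ (1 / r)

/-- The Benford measure `β_b` on `[1,b]`: the law of `b^U` with `U` uniform on `[0,1)`. -/
def benford (b : ℝ) : Measure ℝ := (volume.restrict (Ico (0 : ℝ) 1)).map (fun t : ℝ => b ^ t)

/-- The map `T_{f,a}(x) = f₊(f⁻¹(x+a) + 2a) + a`. -/
def Tmap (f : ℝ → EReal) (a : ℝ) : EReal → EReal :=
  fun x => fplus f (upperInvE f (x + (a : EReal)) + ((2 * a : ℝ) : EReal)) + (a : EReal)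

/-- The map `S_{f,a}(x) = f₊(f⁻¹(x+a)) + a`. -/
def Smap (f : ℝ → EReal) (a : ℝ) : EReal → EReal :=
  fun x => fplus f (upperInvE f (x + (a : EReal))) + (a : EReal)

/-- `L_•^{•,n} = min {a ≥ 0 : T_{F_μ,a}^{[n]}(0) ≥ 1}`. -/
def LBB (μ : Measure ℝ) (A B : ℝ) (n : ℕ) : ℝ :=
  sInf {a : ℝ | 0 ≤ a ∧ (1 : EReal) ≤ (Tmap (cdfEReal μ A B) a)^[n] ((0 : ℝ) : EReal)}

/-- `K_•^{•,n} = min {a ≥ 0 : S_{F_μ,a}^{[n]}(0) ≥ 1}`. -/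
def KBB (μ : Measure ℝ) (A B : ℝ) (n : ℕ) : ℝ :=
  sInf {a : ℝ | 0 ≤ a ∧ (1 : EReal) ≤ (Smap (cdfEReal μ A B) a)^[n] ((0 : ℝ) : EReal)}


/-- `K^•(x) = max {F_{μ−}(x_1), (1/2)·max_{j=1,…,n−1}(F_{μ−}(x_{j+1}) − F_μ(x_j)),
1 − F_μ(x_n)}`. -/
def Kbul (μ : Measure ℝ) (A B : ℝ) (n : ℕ) (x : Fin n → ℝ) : ℝ :=
  Finset.sup' (Finset.range (n + 1)) (Finset.nonempty_range_iff.mpr (Nat.succ_ne_zero n))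
    fun j =>
      if j = 0 then cdfm μ A B (xcoord n x 0)
      else if j = n then 1 - cdf μ A B (xcoord n x (n - 1))
      else (cdfm μ A B (xcoord n x j) - cdf μ A B (xcoord n x (j - 1))) / 2

section CdfBasics

variable {μ : Measure ℝ} {A B : ℝ}

lemma cdf_nonneg (t : ℝ) : 0 ≤ cdf μ A B t := ENNReal.toReal_nonneg

lemma cdf_le_one [IsProbabilityMeasure μ] (t : ℝ) : cdf μ A B t ≤ 1 := measureReal_le_one

lemma cdf_mono [IsProbabilityMeasure μ] : Monotone (cdf μ A B) := fun _ _ hst =>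
  measureReal_mono (inter_subset_inter_right _ (Iic_subset_Iic.mpr hst))

lemma bddAbove_image_cdf [IsProbabilityMeasure μ] (s : Set ℝ) : BddAbove (cdf μ A B '' s) :=
  ⟨1, by rintro _ ⟨t, -, rfl⟩; exact cdf_le_one t⟩

lemma cdf_eq_one_of_ge (hμ : μ (Icc A B) = 1) {t : ℝ} (ht : B ≤ t) : cdf μ A B t = 1 := by
  have : Icc A B ∩ Iic t = Icc A B := inter_eq_left.mpr fun y hy => hy.2.trans ht
  simp [cdf, this, hμ]

lemma cdf_le_cdfL [IsProbabilityMeasure μ] {t : ℝ} {a : EReal} (h : (t : EReal) < a) :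
    cdf μ A B t ≤ cdfL μ A B a :=
  le_csSup (bddAbove_image_cdf _) ⟨t, h, rfl⟩

lemma cdfL_le {a : EReal} {c : ℝ} (ha : a ≠ ⊥) (h : ∀ t : ℝ, (t : EReal) < a → cdf μ A B t ≤ c) :
    cdfL μ A B a ≤ c := by
  obtain ⟨t, -, ht⟩ := EReal.lt_iff_exists_real_btwn.mp (bot_lt_iff_ne_bot.mpr ha)
  refine csSup_le ⟨_, t, ht, rfl⟩ ?_
  rintro _ ⟨s, hs, rfl⟩
  exact h s hs

lemma cdfL_coe (t : ℝ) : cdfL μ A B (t : EReal) = cdfm μ A B t := by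
  simp [cdfL, cdfm, Iio]

lemma cdfL_top [IsProbabilityMeasure μ] (hμ : μ (Icc A B) = 1) : cdfL μ A B ⊤ = 1 :=
  le_antisymm (cdfL_le (by simp) fun t _ => cdf_le_one t)
    ((cdf_eq_one_of_ge hμ le_rfl).symm.le.trans (cdf_le_cdfL (EReal.coe_lt_top B)))

lemma cdfE_coe (t : ℝ) : cdfE μ A B (t : EReal) = cdf μ A B t := by
  simp [cdfE, cdf, Iic]

lemma cdfE_bot : cdfE μ A B ⊥ = 0 := by
  simp [cdfE]

lemma cdfE_le_cdf [IsProbabilityMeasure μ] {t : ℝ} {a : EReal} (h : a ≤ (t : EReal)) :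
    cdfE μ A B a ≤ cdf μ A B t :=
  measureReal_mono (inter_subset_inter_right _ fun _ hy => EReal.coe_le_coe_iff.mp (le_trans hy h))

lemma cdfm_nonneg [IsProbabilityMeasure μ] (t : ℝ) : 0 ≤ cdfm μ A B t :=
  (cdf_nonneg (t - 1)).trans (le_csSup (bddAbove_image_cdf _) ⟨t - 1, by simp, rfl⟩)

lemma cdfm_le_cdf [IsProbabilityMeasure μ] (t : ℝ) : cdfm μ A B t ≤ cdf μ A B t := by
  refine csSup_le ⟨_, t - 1, by simp, rfl⟩ ?_
  rintro _ ⟨s, hs, rfl⟩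
  exact cdf_mono (le_of_lt hs)

end CdfBasics

section Locations

variable {n : ℕ} {x : Fin n → ℝ}

lemma extPts_zero : extPts n x 0 = ⊥ := by simp [extPts]

lemma extPts_succ {j : ℕ} (h : j < n) : extPts n x (j + 1) = (x ⟨j, h⟩ : ℝ) := by
  simp [extPts, Nat.succ_le_of_lt h]

lemma extPts_last : extPts n x (n + 1) = ⊤ := by simp [extPts]

lemma xcoord_of_lt {j : ℕ} (h : j < n) : xcoord n x j = x ⟨j, h⟩ := by simp [xcoord, h]

lemma coord_le_of_extPts_le (hx : Monotone x) {j : ℕ} (hj : j ≤ n) {t : ℝ}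
    (h : extPts n x j ≤ t) {i : Fin n} (hi : (i : ℕ) < j) : x i ≤ t := by
  obtain ⟨k, rfl⟩ := Nat.exists_eq_succ_of_ne_zero (Nat.ne_zero_of_lt hi)
  rw [Nat.succ_eq_add_one, extPts_succ hj, EReal.coe_le_coe_iff] at h
  exact (hx (Fin.le_def.mpr (Nat.lt_succ_iff.mp hi))).trans h

lemma lt_coord_of_lt_extPts (hx : Monotone x) {j : ℕ} {t : ℝ}
    (h : (t : EReal) < extPts n x (j + 1)) {i : Fin n} (hi : j ≤ (i : ℕ)) : t < x i := by
  rw [extPts_succ (hi.trans_lt i.2), EReal.coe_lt_coe_iff] at h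
  exact h.trans_le (hx (Fin.le_def.mpr hi))

lemma exists_extPts_le_lt (t : ℝ) :
    ∃ j ≤ n, extPts n x j ≤ t ∧ (t : EReal) < extPts n x (j + 1) := by
  classical
  have h0 : extPts n x 0 ≤ t := by simp [extPts_zero]
  refine ⟨Nat.findGreatest (fun j => extPts n x j ≤ t) n, Nat.findGreatest_le n,
    Nat.findGreatest_spec (P := fun j => extPts n x j ≤ t) (Nat.zero_le n) h0, ?_⟩
  rcases (Nat.findGreatest_le (P := fun j => extPts n x j ≤ t) n).eq_or_lt with h | h
  · rw [h, extPts_last]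
    exact EReal.coe_lt_top t
  · exact not_le.mp (Nat.findGreatest_is_greatest (Nat.lt_succ_self _) h)

lemma extPts_succ_ne_bot {j : ℕ} (hj : j ≤ n) : extPts n x (j + 1) ≠ ⊥ := by
  rcases hj.eq_or_lt with rfl | h
  · simp [extPts_last]
  · simp [extPts_succ h]

lemma exists_real_extPts_le_lt {j : ℕ} (h : extPts n x j < extPts n x (j + 1)) :
    ∃ s : ℝ, extPts n x j ≤ s ∧ (s : EReal) < extPts n x (j + 1) :=
  let ⟨s, hs, hs'⟩ := EReal.lt_iff_exists_real_btwn.mp h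
  ⟨s, hs.le, hs'⟩

end Locations

section Discrete

variable {n : ℕ} {x p : Fin n → ℝ} {A B : ℝ}

lemma cdf_discr (hxI : ∀ j, x j ∈ Icc A B) (hp : ∀ j, 0 ≤ p j) (t : ℝ) :
    cdf (discr n x p) A B t = ∑ j, if x j ≤ t then p j else 0 := by
  have hm : MeasurableSet (Icc A B ∩ Iic t) := measurableSet_Icc.inter measurableSet_Iic
  simp only [cdf, discr, Measure.finsetSum_apply, Measure.smul_apply,
    Measure.dirac_apply' _ hm, smul_eq_mul]
  rw [ENNReal.toReal_sum]
  · refine Finset.sum_congr rfl fun j _ => ?_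
    by_cases h : x j ≤ t
    · have hmem : x j ∈ Icc A B ∩ Iic t := ⟨hxI j, h⟩
      simp [h, hmem, ENNReal.toReal_ofReal (hp j)]
    · have hmem : x j ∉ Icc A B ∩ Iic t := fun hj => h hj.2
      simp [h, hmem]
  · intro j _
    refine ENNReal.mul_ne_top ENNReal.ofReal_ne_top ?_
    by_cases hmem : x j ∈ Icc A B ∩ Iic t <;> simp [hmem]

lemma cdf_discr_eq_psum (hx : IsXi A B n x) (hp : ∀ j, 0 ≤ p j) {j : ℕ} (hj : j ≤ n) {t : ℝ}
    (hl : extPts n x j ≤ t) (hr : (t : EReal) < extPts n x (j + 1)) :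
    cdf (discr n x p) A B t = psum n p j := by
  rw [cdf_discr hx.1 hp, psum]
  refine Finset.sum_congr rfl fun i _ => ?_
  rcases lt_or_ge (i : ℕ) j with h | h
  · simp [h, coord_le_of_extPts_le hx.2 hj hl h]
  · simp [h.not_gt, (lt_coord_of_lt_extPts hx.2 hr h).not_ge]

lemma isProbabilityMeasure_discr (hp : IsPi n p) : IsProbabilityMeasure (discr n x p) := by
  constructor
  simp only [discr, Measure.finsetSum_apply, Measure.smul_apply, measure_univ, smul_eq_mul,
    mul_one]
  rw [← ENNReal.ofReal_sum_of_nonneg fun j _ => hp.1 j, hp.2, ENNReal.ofReal_one]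

lemma psum_zero : psum n p 0 = 0 := by simp [psum]

lemma psum_self : psum n p n = ∑ j, p j := by simp [psum]

/-- The partial sums of the increments of a sequence telescope. -/
lemma psum_increments {P : ℕ → ℝ} (hP : P 0 = 0) {j : ℕ} (hj : j ≤ n) :
    psum n (fun i : Fin n => P (i + 1) - P i) j = P j := by
  have h := Fin.sum_univ_eq_sum_range (fun i => if i < j then P (i + 1) - P i else 0) n
  rw [psum, h, ← Finset.sum_filter]
  have hf : (Finset.range n).filter (· < j) = Finset.range j := by
    ext i; simp only [Finset.mem_filter, Finset.mem_range]; omega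
  rw [hf, Finset.sum_range_sub, hP, sub_zero]

end Discrete

section Kolmogorov

variable {μ ν : Measure ℝ} {A B : ℝ}

lemma abs_cdf_sub_cdf_le_dKol [IsProbabilityMeasure μ] [IsProbabilityMeasure ν] (t : ℝ) :
    |cdf μ A B t - cdf ν A B t| ≤ dKol A B μ ν := by
  refine le_csSup ⟨1, ?_⟩ ⟨t, rfl⟩
  rintro _ ⟨s, rfl⟩
  have h₁ := cdf_nonneg (μ := μ) (A := A) (B := B) s
  have h₂ := cdf_nonneg (μ := ν) (A := A) (B := B) s
  have h₃ := cdf_le_one (μ := μ) (A := A) (B := B) s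
  have h₄ := cdf_le_one (μ := ν) (A := A) (B := B) s
  exact abs_sub_le_iff.mpr ⟨by linarith, by linarith⟩

lemma dKol_nonneg : 0 ≤ dKol A B μ ν :=
  Real.sSup_nonneg (by rintro _ ⟨t, rfl⟩; exact abs_nonneg _)

lemma dKol_le_iff [IsProbabilityMeasure μ] [IsProbabilityMeasure ν] {c : ℝ} :
    dKol A B μ ν ≤ c ↔ ∀ t, |cdf μ A B t - cdf ν A B t| ≤ c :=
  ⟨fun h t => (abs_cdf_sub_cdf_le_dKol t).trans h, fun h =>
    csSup_le (range_nonempty _) (by rintro _ ⟨t, rfl⟩; exact h t)⟩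

variable {n : ℕ} {x p : Fin n → ℝ}

/-- The distance to `δ_x^p` is at most `c` iff the partial sums of `p` lie in the prescribed
bands. -/
lemma dKol_discr_le_iff [IsProbabilityMeasure μ] (hx : IsXi A B n x) (hp : IsPi n p)
    {c : ℝ} (hc : 0 ≤ c) :
    dKol A B μ (discr n x p) ≤ c ↔
      ∀ j : ℕ, j ≤ n → extPts n x j < extPts n x (j + 1) →
        cdfL μ A B (extPts n x (j + 1)) - c ≤ psum n p j ∧
          psum n p j ≤ cdfE μ A B (extPts n x j) + c := by
  have := isProbabilityMeasure_discr (x := x) hp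
  rw [dKol_le_iff]
  constructor
  · intro h j hj hlt
    obtain ⟨s, hs, hs'⟩ := exists_real_extPts_le_lt hlt
    constructor
    · rw [sub_le_iff_le_add]
      refine cdfL_le (extPts_succ_ne_bot hj) fun t ht => ?_
      have hl : extPts n x j ≤ ((max t s : ℝ) : EReal) :=
        hs.trans (EReal.coe_le_coe_iff.mpr (le_max_right t s))
      have hr : ((max t s : ℝ) : EReal) < extPts n x (j + 1) := by
        rcases max_choice t s with h | h <;> rw [h] <;> assumption
      have hm := h (max t s)
      rw [cdf_discr_eq_psum hx hp.1 hj hl hr] at hm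
      have hmono := cdf_mono (μ := μ) (A := A) (B := B) (le_max_left t s)
      linarith [(abs_le.mp hm).2]
    · rcases j with _ | j
      · simpa [psum_zero, extPts_zero, cdfE_bot] using hc
      · rw [extPts_succ hj] at hlt ⊢
        have hm := h (x ⟨j, hj⟩)
        rw [cdf_discr_eq_psum hx hp.1 hj (extPts_succ hj).le hlt] at hm
        rw [cdfE_coe]
        linarith [(abs_le.mp hm).1]
  · intro h t
    obtain ⟨j, hj, hl, hr⟩ := exists_extPts_le_lt (n := n) (x := x) t
    obtain ⟨h₁, h₂⟩ := h j hj (hl.trans_lt hr)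
    have h₃ := cdfE_le_cdf (μ := μ) (A := A) (B := B) hl
    have h₄ := cdf_le_cdfL (μ := μ) (A := A) (B := B) hr
    rw [cdf_discr_eq_psum hx hp.1 hj hl hr]
    exact abs_sub_le_iff.mpr ⟨by linarith, by linarith⟩

lemma Kbul_le_iff (hn : 0 < n) {c : ℝ} :
    Kbul μ A B n x ≤ c ↔ cdfm μ A B (x ⟨0, hn⟩) ≤ c ∧
      1 - cdf μ A B (x ⟨n - 1, by omega⟩) ≤ c ∧
      ∀ (j : ℕ) (hj : j + 1 < n),
        (cdfm μ A B (x ⟨j + 1, hj⟩) - cdf μ A B (x ⟨j, by omega⟩)) / 2 ≤ c := by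
  simp only [Kbul, Finset.sup'_le_iff, Finset.mem_range]
  constructor
  · intro h
    refine ⟨?_, ?_, fun j hj => ?_⟩
    · simpa [xcoord_of_lt hn] using h 0 (by omega)
    · have hn' : n - 1 < n := by omega
      simpa [hn.ne', xcoord_of_lt hn'] using h n (by omega)
    · have hj' : j < n := by omega
      simpa [hj.ne, xcoord_of_lt hj, xcoord_of_lt hj'] using h (j + 1) (by omega)
  · rintro ⟨h₀, h₁, h₂⟩ j hj
    split_ifs with hj0 hjn
    · rwa [xcoord_of_lt hn]
    · rwa [xcoord_of_lt (Nat.sub_lt hn one_pos)]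
    · obtain ⟨k, rfl⟩ := Nat.exists_eq_succ_of_ne_zero hj0
      have hk : k + 1 < n := by omega
      simpa [xcoord_of_lt hk, xcoord_of_lt (Nat.lt_of_succ_lt hk)] using h₂ k hk

lemma Kbul_nonneg [IsProbabilityMeasure μ] (hn : 0 < n) : 0 ≤ Kbul μ A B n x :=
  (cdfm_nonneg _).trans ((Kbul_le_iff hn).mp le_rfl).1

lemma Kbul_le_dKol_discr [IsProbabilityMeasure μ] (hn : 0 < n) (hx : IsXi A B n x)
    (hp : IsPi n p) : Kbul μ A B n x ≤ dKol A B μ (discr n x p) := by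
  have hc : 0 ≤ dKol A B μ (discr n x p) := dKol_nonneg
  have h := (dKol_discr_le_iff (μ := μ) hx hp hc).mp le_rfl
  refine (Kbul_le_iff hn).mpr ⟨?_, ?_, fun j hj => ?_⟩
  · have h₀ := (h 0 (Nat.zero_le n) (by simp [extPts_zero, extPts_succ hn])).1
    rw [extPts_succ hn, cdfL_coe, psum_zero] at h₀
    linarith
  · obtain ⟨m, rfl⟩ := Nat.exists_eq_succ_of_ne_zero hn.ne'
    have hm : m < m + 1 := Nat.lt_succ_self m
    have h₁ := (h (m + 1) le_rfl (by
      rw [extPts_last, extPts_succ hm]; exact EReal.coe_lt_top _)).2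
    rw [extPts_succ hm, cdfE_coe, psum_self, hp.2] at h₁
    simp only [Nat.succ_eq_add_one, Nat.add_sub_cancel]
    linarith
  · have hj' : j < n := Nat.lt_of_succ_lt hj
    have hle : x ⟨j, hj'⟩ ≤ x ⟨j + 1, hj⟩ := hx.2 (Fin.le_def.mpr (Nat.le_succ j))
    rcases hle.eq_or_lt with heq | hlt
    · have := cdfm_le_cdf (μ := μ) (A := A) (B := B) (x ⟨j + 1, hj⟩)
      rw [heq]
      linarith
    · have h₂ := h (j + 1) hj.le (by
        rwa [extPts_succ hj, extPts_succ hj', EReal.coe_lt_coe_iff])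
      rw [extPts_succ hj, extPts_succ hj', cdfL_coe, cdfE_coe] at h₂
      linarith [h₂.1, h₂.2]

/-- Partial sums of the weights `P_j = min {1, F_μ(x_j) + K^•(x)}`, `0 < j < n`, that realize
the optimal distance. -/
def optSum (μ : Measure ℝ) (A B : ℝ) (n : ℕ) (x : Fin n → ℝ) (j : ℕ) : ℝ :=
  if j = 0 then 0 else if n ≤ j then 1
  else min 1 (cdf μ A B (xcoord n x (j - 1)) + Kbul μ A B n x)

lemma optSum_mono [IsProbabilityMeasure μ] (hn : 0 < n) (hx : Monotone x) :
    Monotone (optSum μ A B n x) := by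
  have hK : 0 ≤ Kbul μ A B n x := Kbul_nonneg hn
  refine monotone_nat_of_le_succ fun j => ?_
  rcases j with _ | j
  · have h₀ := cdf_nonneg (μ := μ) (A := A) (B := B) (xcoord n x 0)
    by_cases h : n ≤ 1
    · simp [optSum, h]
    · simpa [optSum, h] using by positivity
  · by_cases h₁ : n ≤ j + 1
    · simp [optSum, h₁, h₁.trans (Nat.le_succ _)]
    · by_cases h₂ : n ≤ j + 2
      · simp [optSum, h₁, h₂]
      · have hj : j + 1 < n := by omega
        have hj' : j < n := by omega
        simp only [optSum, Nat.succ_ne_zero, if_false, h₁, h₂, Nat.add_sub_cancel,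
          xcoord_of_lt hj, xcoord_of_lt hj']
        gcongr
        exact cdf_mono (hx (Fin.le_def.mpr (Nat.le_succ j)))

lemma exists_dKol_discr_le_Kbul [IsProbabilityMeasure μ] (hμ : μ (Icc A B) = 1)
    (hn : 0 < n) (hx : IsXi A B n x) :
    ∃ p, IsPi n p ∧ dKol A B μ (discr n x p) ≤ Kbul μ A B n x := by
  have hK : 0 ≤ Kbul μ A B n x := Kbul_nonneg hn
  obtain ⟨hK₀, hK₁, hK₂⟩ := (Kbul_le_iff (μ := μ) (A := A) (B := B) (x := x) hn).mp le_rfl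
  have h0 : optSum μ A B n x 0 = 0 := by simp [optSum]
  have h1 : optSum μ A B n x n = 1 := by simp [optSum, hn.ne']
  set p : Fin n → ℝ := fun i => optSum μ A B n x (i + 1) - optSum μ A B n x i
  have hps : ∀ j ≤ n, psum n p j = optSum μ A B n x j := fun j hj => psum_increments h0 hj
  have hp : IsPi n p :=
    ⟨fun i => sub_nonneg.mpr (optSum_mono hn hx.2 (Nat.le_succ i)), by
      rw [← psum_self, hps n le_rfl, h1]⟩
  refine ⟨p, hp, (dKol_discr_le_iff hx hp hK).mpr fun j hj _ => ?_⟩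
  rw [hps j hj]
  rcases j with _ | j
  · rw [h0, extPts_zero, cdfE_bot, extPts_succ hn, cdfL_coe]
    exact ⟨by linarith, by linarith⟩
  · rcases hj.eq_or_lt with rfl | hj
    · have hm : j < j + 1 := Nat.lt_succ_self j
      rw [h1, extPts_last, cdfL_top hμ, extPts_succ hm, cdfE_coe]
      simp only [Nat.add_sub_cancel] at hK₁
      exact ⟨by linarith, by linarith⟩
    · have hj' : j < n := Nat.lt_of_succ_lt hj
      have hopt : optSum μ A B n x (j + 1) =
          min 1 (cdf μ A B (x ⟨j, hj'⟩) + Kbul μ A B n x) := by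
        simp [optSum, hj, xcoord_of_lt hj']
      rw [hopt, extPts_succ hj, extPts_succ hj', cdfL_coe, cdfE_coe]
      have hle := (cdfm_le_cdf (μ := μ) (A := A) (B := B) (x ⟨j + 1, hj⟩)).trans (cdf_le_one _)
      exact ⟨le_min (by linarith) (by linarith [hK₂ j hj]), min_le_right _ _⟩

end Kolmogorov

/-- Thm. 5.1: existence and characterization of best Kolmogorov-distance
approximations of `μ` with prescribed locations `x ∈ Ξ_n`. -/
theorem best_dKol_given_locations (A B : ℝ) (hAB : A < B) (μ : Measure ℝ)
    [IsProbabilityMeasure μ] (hμ : μ (Icc A B) = 1) (n : ℕ) (hn : 0 < n)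
    (x : Fin n → ℝ) (hx : IsXi A B n x) :
    (∃ p : Fin n → ℝ, IsPi n p ∧ ∀ q : Fin n → ℝ, IsPi n q →
      dKol A B μ (discr n x p) ≤ dKol A B μ (discr n x q)) ∧
    ∀ p : Fin n → ℝ, IsPi n p →
      (((∀ q : Fin n → ℝ, IsPi n q →
          dKol A B μ (discr n x p) ≤ dKol A B μ (discr n x q)) ↔
        (∀ j : ℕ, j ≤ n → extPts n x j < extPts n x (j + 1) →
          cdfL μ A B (extPts n x (j + 1)) - Kbul μ A B n x ≤ psum n p j ∧
            psum n p j ≤ cdfE μ A B (extPts n x j) + Kbul μ A B n x)) ∧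
      ((∀ q : Fin n → ℝ, IsPi n q →
          dKol A B μ (discr n x p) ≤ dKol A B μ (discr n x q)) →
        dKol A B μ (discr n x p) = Kbul μ A B n x)) := by
  obtain ⟨p₀, hp₀, hle₀⟩ := exists_dKol_discr_le_Kbul hμ hn hx
  have hlb : ∀ q, IsPi n q → Kbul μ A B n x ≤ dKol A B μ (discr n x q) :=
    fun q hq => Kbul_le_dKol_discr hn hx hq
  refine ⟨⟨p₀, hp₀, fun q hq => hle₀.trans (hlb q hq)⟩, fun p hp => ⟨?_, fun h =>
    le_antisymm ((h p₀ hp₀).trans hle₀) (hlb p hp)⟩⟩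
  rw [← dKol_discr_le_iff hx hp (Kbul_nonneg hn)]
  exact ⟨fun h => (h p₀ hp₀).trans hle₀, fun h q hq => h.trans (hlb q hq)⟩

end BenfordApprox
end
end

section
/- Let b > 1 and n ∈ ℕ. Then δ_x^{u_n} with x_j = b^{(2j−1)/(2n)} for j = 1,…,n is the unique best Kolmogorov-distance approximation of the Benford measure β_b among all probability measures supported on at most n points (and equivalently the unique best uniform d_K-approximation), and min_{y∈Ξ_n, q∈Π_n} d_K(β_b, δ_y^q) = 1/(2n). -/
open MeasureTheory Filter Set

noncomputable section

namespace BenfordApprox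

/-- The distribution function of `discr n y q` as a finite sum. -/
lemma cdf_discr_s19 {b : ℝ} {n : ℕ} {y q : Fin n → ℝ} (hy : IsXi 1 b n y) (hq : IsPi n q) (t : ℝ) :
    cdf (discr n y q) 1 b t = ∑ j with y j ≤ t, q j := by
  have hm : MeasurableSet (Icc 1 b ∩ Iic t) := measurableSet_Icc.inter measurableSet_Iic
  simp only [cdf, discr, Measure.coe_finsetSum, Finset.sum_apply, Measure.smul_apply,
    smul_eq_mul, Measure.dirac_apply' _ hm]
  rw [ENNReal.toReal_sum, Finset.sum_filter]
  · refine Finset.sum_congr rfl fun j _ => ?_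
    by_cases h : y j ≤ t
    · have : y j ∈ Icc 1 b ∩ Iic t := ⟨hy.1 j, h⟩
      simp [this, h, hq.1 j]
    · have : y j ∉ Icc 1 b ∩ Iic t := fun h' => h h'.2
      simp [this, h]
  · intro j _
    refine ENNReal.mul_ne_top ENNReal.ofReal_ne_top ?_
    by_cases h : y j ∈ Icc 1 b ∩ Iic t <;> simp [h]

/-- The distribution function of the Benford measure, on the logarithmic scale. -/
lemma cdf_benford {b : ℝ} (hb : 1 < b) {s : ℝ} (hs : s ∈ Icc (0 : ℝ) 1) :
    cdf (benford b) 1 b (b ^ s) = s := by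
  have hm : MeasurableSet (Icc 1 b ∩ Iic (b ^ s)) := measurableSet_Icc.inter measurableSet_Iic
  have hf : Measurable fun t : ℝ => b ^ t :=
    (Real.continuous_const_rpow (by linarith)).measurable
  have hset : (fun t : ℝ => b ^ t) ⁻¹' (Icc 1 b ∩ Iic (b ^ s)) = Icc 0 s := by
    ext u
    have h1 : 1 ≤ b ^ u ↔ 0 ≤ u := by
      simpa using Real.rpow_le_rpow_left_iff (y := 0) (z := u) hb
    have h2 : b ^ u ≤ b ↔ u ≤ 1 := by
      simpa using Real.rpow_le_rpow_left_iff (y := u) (z := 1) hb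
    simp only [mem_preimage, mem_inter_iff, mem_Icc, mem_Iic, h1, h2,
      Real.rpow_le_rpow_left_iff hb]
    exact ⟨fun h => ⟨h.1.1, h.2⟩, fun h => ⟨⟨h.1, h.2.trans hs.2⟩, h.2⟩⟩
  rw [cdf, benford, Measure.map_apply hf hm, hset, restrict_Ico_eq_restrict_Icc,
    Measure.restrict_apply measurableSet_Icc, inter_eq_left.2 (Icc_subset_Icc_right hs.2)]
  simp [hs.1]

/-- Distribution functions on `[1,b]` are determined by their values at the points `b ^ s`
with `s ∈ [0,1]`. -/
lemma cdf_eq_zero_or_eq_cdf_rpow {b : ℝ} (hb : 1 < b) (t : ℝ) :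
    (∀ μ : Measure ℝ, cdf μ 1 b t = 0) ∨
      ∃ s ∈ Icc (0 : ℝ) 1, ∀ μ : Measure ℝ, cdf μ 1 b t = cdf μ 1 b (b ^ s) := by
  rcases lt_or_ge t 1 with ht | ht
  · left
    intro μ
    have : Icc 1 b ∩ Iic t = ∅ := by
      ext u
      simp only [mem_inter_iff, mem_Icc, mem_Iic, mem_empty_iff_false, iff_false]
      rintro ⟨⟨h1, -⟩, h2⟩
      linarith
    simp [cdf, this]
  · right
    rcases le_or_gt b t with hbt | hbt
    · refine ⟨1, by simp, fun μ => ?_⟩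
      rw [cdf, cdf, Real.rpow_one, inter_eq_left.2 fun u hu => hu.2.trans hbt,
        inter_eq_left.2 fun u hu => hu.2]
    · have hs : b ^ Real.logb b t = t := Real.rpow_logb (by linarith) hb.ne' (by linarith)
      refine ⟨Real.logb b t, ⟨Real.logb_nonneg hb ht, ?_⟩, fun μ => by rw [hs]⟩
      rw [← Real.rpow_le_rpow_left_iff hb, hs, Real.rpow_one]
      exact hbt.le

/-- To bound the Kolmogorov distance to the Benford measure it suffices to test the points
`b ^ s` with `s ∈ [0,1]`. -/
lemma abs_cdf_sub_le {b : ℝ} (hb : 1 < b) {n : ℕ} {y q : Fin n → ℝ} (hy : IsXi 1 b n y)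
    (hq : IsPi n q) {d : ℝ} (hd : 0 ≤ d)
    (h : ∀ s ∈ Icc (0 : ℝ) 1, |s - ∑ j with y j ≤ b ^ s, q j| ≤ d) (t : ℝ) :
    |cdf (benford b) 1 b t - cdf (discr n y q) 1 b t| ≤ d := by
  rcases cdf_eq_zero_or_eq_cdf_rpow hb t with h0 | ⟨s, hs, hs'⟩
  · simpa [h0] using hd
  · rw [hs', hs', cdf_benford hb hs, cdf_discr_s19 hy hq]
    exact h s hs

lemma abs_sub_sum_le_dKol {b : ℝ} (hb : 1 < b) {n : ℕ} {y q : Fin n → ℝ} (hy : IsXi 1 b n y)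
    (hq : IsPi n q) {s : ℝ} (hs : s ∈ Icc (0 : ℝ) 1) :
    |s - ∑ j with y j ≤ b ^ s, q j| ≤ dKol 1 b (benford b) (discr n y q) := by
  have hbdd : BddAbove (range fun t : ℝ => |cdf (benford b) 1 b t - cdf (discr n y q) 1 b t|) := by
    refine ⟨1, ?_⟩
    rintro _ ⟨t, rfl⟩
    refine abs_cdf_sub_le hb hy hq zero_le_one (fun s hs => ?_) t
    have h0 : 0 ≤ ∑ j with y j ≤ b ^ s, q j := Finset.sum_nonneg fun j _ => hq.1 j
    have h1 : ∑ j with y j ≤ b ^ s, q j ≤ 1 := hq.2 ▸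
      Finset.sum_le_sum_of_subset_of_nonneg (Finset.filter_subset _ _) fun j _ _ => hq.1 j
    rw [abs_le]
    constructor <;> linarith [hs.1, hs.2]
  refine le_csSup hbdd ⟨b ^ s, ?_⟩
  simp only [cdf_benford hb hs, cdf_discr_s19 hy hq]

/-- The two sides of the jump at `y k` constrain its logarithmic position. -/
lemma logb_bounds {b : ℝ} (hb : 1 < b) {n : ℕ} {y q : Fin n → ℝ} (hy : IsXi 1 b n y)
    (hq : IsPi n q) (k : Fin n) :
    Real.logb b (y k) ≤ ∑ j ∈ Finset.Iio k, q j + dKol 1 b (benford b) (discr n y q) ∧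
    ∑ j ∈ Finset.Iio k, q j + q k ≤
      Real.logb b (y k) + dKol 1 b (benford b) (discr n y q) := by
  set d := dKol 1 b (benford b) (discr n y q)
  have hyk := hy.1 k
  have hz : b ^ Real.logb b (y k) = y k :=
    Real.rpow_logb (by linarith) hb.ne' (by linarith [hyk.1])
  have hz0 : 0 ≤ Real.logb b (y k) := Real.logb_nonneg hb hyk.1
  have hz1 : Real.logb b (y k) ≤ 1 := by
    rw [← Real.rpow_le_rpow_left_iff hb, hz, Real.rpow_one]
    exact hyk.2
  have hd : 0 ≤ d := (abs_nonneg _).trans (abs_sub_sum_le_dKol hb hy hq ⟨hz0, hz1⟩)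
  constructor
  · refine le_of_forall_lt_imp_le_of_dense fun s hs => ?_
    rcases lt_or_ge s 0 with h | h
    · have : 0 ≤ ∑ j ∈ Finset.Iio k, q j := Finset.sum_nonneg fun j _ => hq.1 j
      linarith
    · have hs' := abs_le.1 (abs_sub_sum_le_dKol hb hy hq ⟨h, hs.le.trans hz1⟩)
      have hle : ∑ j with y j ≤ b ^ s, q j ≤ ∑ j ∈ Finset.Iio k, q j := by
        refine Finset.sum_le_sum_of_subset_of_nonneg (fun j hj => ?_) fun j _ _ => hq.1 j
        rw [Finset.mem_Iio]
        by_contra! hkj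
        have h1 := hy.2 hkj
        have h2 := Real.rpow_lt_rpow_of_exponent_lt hb hs
        have h3 := (Finset.mem_filter.1 hj).2
        linarith
      linarith [hs'.2]
  · have hs' := abs_le.1 (abs_sub_sum_le_dKol hb hy hq ⟨hz0, hz1⟩)
    have hle : ∑ j ∈ Finset.Iic k, q j ≤ ∑ j with y j ≤ b ^ Real.logb b (y k), q j := by
      refine Finset.sum_le_sum_of_subset_of_nonneg (fun j hj => ?_) fun j _ _ => hq.1 j
      simpa [hz] using hy.2 (Finset.mem_Iic.1 hj)
    rw [← Finset.Iio_insert, Finset.sum_insert (by simp)] at hle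
    linarith [hs'.1]

/-- No probability measure with at most `n` atoms is closer than `1/(2n)`. -/
lemma one_div_le_dKol {b : ℝ} (hb : 1 < b) {n : ℕ} (hn : 0 < n) {y q : Fin n → ℝ}
    (hy : IsXi 1 b n y) (hq : IsPi n q) :
    1 / (2 * (n : ℝ)) ≤ dKol 1 b (benford b) (discr n y q) := by
  have hsum : ∑ j, q j ≤ ∑ _j : Fin n, 2 * dKol 1 b (benford b) (discr n y q) :=
    Finset.sum_le_sum fun k _ => by
      have := logb_bounds hb hy hq k
      linarith [this.1, this.2]
  rw [hq.2] at hsum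
  simp only [Finset.sum_const, Finset.card_univ, Fintype.card_fin, nsmul_eq_mul] at hsum
  rw [div_le_iff₀ (by positivity)]
  linarith

/-- A measure at distance at most `1/(2n)` has uniform weights and Benford-midpoint atoms. -/
lemma eq_of_dKol_le {b : ℝ} (hb : 1 < b) {n : ℕ} (hn : 0 < n) {y q : Fin n → ℝ}
    (hy : IsXi 1 b n y) (hq : IsPi n q)
    (h : dKol 1 b (benford b) (discr n y q) ≤ 1 / (2 * (n : ℝ))) :
    y = (fun j : Fin n => b ^ ((2 * (j : ℝ) + 1) / (2 * (n : ℝ)))) ∧ q = unif n := by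
  have hn' : (0 : ℝ) < n := by exact_mod_cast hn
  have hhalf : 1 / (n : ℝ) = 1 / (2 * (n : ℝ)) + 1 / (2 * (n : ℝ)) := by
    field_simp
    norm_num
  have hle : ∀ k ∈ Finset.univ, q k ≤ unif n k := fun k _ => by
    have := logb_bounds hb hy hq k
    rw [unif]
    linarith [this.1, this.2]
  have hsum : ∑ k, q k = ∑ k, unif n k := by
    simp [hq.2, unif, hn'.ne']
  have hqu : q = unif n := funext fun k =>
    (Finset.sum_eq_sum_iff_of_le hle).1 hsum k (Finset.mem_univ k)
  refine ⟨funext fun k => ?_, hqu⟩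
  have hk := logb_bounds hb hy hq k
  have hP : ∑ j ∈ Finset.Iio k, q j = (k : ℝ) * (1 / (n : ℝ)) := by
    simp [hqu, unif]
  have hqk : q k = 1 / (n : ℝ) := by rw [hqu, unif]
  rw [hP, hqk] at hk
  have hlog : Real.logb b (y k) = (2 * (k : ℝ) + 1) / (2 * (n : ℝ)) := by
    have : (2 * (k : ℝ) + 1) / (2 * (n : ℝ)) = (k : ℝ) * (1 / (n : ℝ)) + 1 / (2 * (n : ℝ)) := by
      field_simp
    rw [this]
    apply le_antisymm <;> linarith [hk.1, hk.2]
  rw [← hlog, Real.rpow_logb (by linarith) hb.ne' (by linarith [(hy.1 k).1])]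

lemma isPi_unif {n : ℕ} (hn : 0 < n) : IsPi n (unif n) := by
  have hn' : (n : ℝ) ≠ 0 := by exact_mod_cast hn.ne'
  refine ⟨fun j => ?_, ?_⟩
  · rw [unif]
    positivity
  · simp [unif, hn']

lemma isXi_midpoints {b : ℝ} (hb : 1 < b) (n : ℕ) :
    IsXi 1 b n (fun j : Fin n => b ^ ((2 * (j : ℝ) + 1) / (2 * (n : ℝ)))) := by
  refine ⟨fun j => ⟨Real.one_le_rpow hb.le (by positivity), ?_⟩, fun i j hij => ?_⟩
  · have hj : (j : ℝ) + 1 ≤ n := by exact_mod_cast j.2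
    have hj0 : (0 : ℝ) ≤ j := by positivity
    calc b ^ ((2 * (j : ℝ) + 1) / (2 * (n : ℝ))) ≤ b ^ (1 : ℝ) := by
          refine Real.rpow_le_rpow_of_exponent_le hb.le ?_
          rw [div_le_one (by linarith)]
          linarith
      _ = b := Real.rpow_one b
  · have hij' : (i : ℝ) ≤ j := by exact_mod_cast hij
    refine Real.rpow_le_rpow_of_exponent_le hb.le ?_
    gcongr

/-- The uniform measure on the Benford midpoints is at distance at most `1/(2n)`. -/
lemma dKol_midpoints_le {b : ℝ} (hb : 1 < b) {n : ℕ} (hn : 0 < n) :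
    dKol 1 b (benford b)
      (discr n (fun j : Fin n => b ^ ((2 * (j : ℝ) + 1) / (2 * (n : ℝ)))) (unif n)) ≤
      1 / (2 * (n : ℝ)) := by
  have hn' : (0 : ℝ) < n := by exact_mod_cast hn
  refine csSup_le (range_nonempty _) ?_
  rintro _ ⟨t, rfl⟩
  refine abs_cdf_sub_le hb (isXi_midpoints hb n) (isPi_unif hn) (by positivity) (fun s hs => ?_) t
  have hx : 0 ≤ n * s + 1 / 2 := by linarith [mul_nonneg hn'.le hs.1]
  set m := ⌊n * s + 1 / 2⌋₊ with hm
  have hm1 : (m : ℝ) ≤ n * s + 1 / 2 := Nat.floor_le hx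
  have hm2 : n * s + 1 / 2 < m + 1 := Nat.lt_floor_add_one _
  have hmn : m ≤ n := by
    have : (m : ℝ) < n + 1 := by nlinarith [hs.2]
    exact Nat.lt_succ_iff.1 (by exact_mod_cast this)
  have hfilter : (Finset.univ.filter fun j : Fin n =>
      b ^ ((2 * (j : ℝ) + 1) / (2 * (n : ℝ))) ≤ b ^ s) =
      Finset.univ.filter fun j : Fin n => (j : ℕ) < m := by
    refine Finset.filter_congr fun j _ => ?_
    rw [Real.rpow_le_rpow_left_iff hb, div_le_iff₀ (by positivity), ← Nat.succ_le_iff, hm,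
      Nat.le_floor_iff hx]
    push_cast
    constructor <;> intro h <;> linarith
  have hsum : ∑ j ∈ Finset.univ.filter fun j : Fin n =>
      b ^ ((2 * (j : ℝ) + 1) / (2 * (n : ℝ))) ≤ b ^ s, unif n j = m / n := by
    rw [hfilter]
    simp [unif, Fin.card_filter_val_lt, hmn, div_eq_mul_inv]
  rw [hsum, show s - m / n = (n * s - m) / n by field_simp, abs_div, abs_of_pos hn',
    show 1 / (2 * (n : ℝ)) = (1 / 2) / n by field_simp]
  gcongr
  rw [abs_le]
  constructor <;> linarith

/-- Cor. 5.8: `δ_x^{u_n}` with `x_j = b^{(2j−1)/(2n)}` is the unique best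
Kolmogorov-distance approximation of the Benford measure `β_b` with at most `n` atoms
(equivalently, the unique best uniform one), and the minimal distance is `1/(2n)`. -/
theorem best_dKol_benford (b : ℝ) (hb : 1 < b) (n : ℕ) (hn : 0 < n) :
    IsXi 1 b n (fun j : Fin n => b ^ ((2 * (j : ℝ) + 1) / (2 * (n : ℝ)))) ∧
    -- best among all measures with at most n atoms
    (∀ y q : Fin n → ℝ, IsXi 1 b n y → IsPi n q →
      dKol 1 b (benford b)
          (discr n (fun j : Fin n => b ^ ((2 * (j : ℝ) + 1) / (2 * (n : ℝ)))) (unif n)) ≤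
        dKol 1 b (benford b) (discr n y q)) ∧
    -- uniqueness among all measures with at most n atoms
    (∀ y q : Fin n → ℝ, IsXi 1 b n y → IsPi n q →
      (∀ y' q' : Fin n → ℝ, IsXi 1 b n y' → IsPi n q' →
        dKol 1 b (benford b) (discr n y q) ≤ dKol 1 b (benford b) (discr n y' q')) →
      discr n y q =
        discr n (fun j : Fin n => b ^ ((2 * (j : ℝ) + 1) / (2 * (n : ℝ)))) (unif n)) ∧
    -- uniqueness among uniform measures
    (∀ y : Fin n → ℝ, IsXi 1 b n y →
      (∀ z : Fin n → ℝ, IsXi 1 b n z →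
        dKol 1 b (benford b) (discr n y (unif n)) ≤
          dKol 1 b (benford b) (discr n z (unif n))) →
      discr n y (unif n) =
        discr n (fun j : Fin n => b ^ ((2 * (j : ℝ) + 1) / (2 * (n : ℝ)))) (unif n)) ∧
    dKol 1 b (benford b)
        (discr n (fun j : Fin n => b ^ ((2 * (j : ℝ) + 1) / (2 * (n : ℝ)))) (unif n)) =
      1 / (2 * (n : ℝ)) := by
  have hmid : dKol 1 b (benford b)
      (discr n (fun j : Fin n => b ^ ((2 * (j : ℝ) + 1) / (2 * (n : ℝ)))) (unif n)) =
      1 / (2 * (n : ℝ)) :=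
    (dKol_midpoints_le hb hn).antisymm (one_div_le_dKol hb hn (isXi_midpoints hb n) (isPi_unif hn))
  refine ⟨isXi_midpoints hb n, fun y q hy hq => ?_, fun y q hy hq h => ?_, fun y hy h => ?_, hmid⟩
  · exact hmid.trans_le (one_div_le_dKol hb hn hy hq)
  · obtain ⟨h1, h2⟩ := eq_of_dKol_le hb hn hy hq
      ((h _ _ (isXi_midpoints hb n) (isPi_unif hn)).trans_eq hmid)
    rw [h1, h2]
  · obtain ⟨h1, -⟩ := eq_of_dKol_le hb hn hy (isPi_unif hn)
      ((h _ (isXi_midpoints hb n)).trans_eq hmid)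
    rw [h1]

end BenfordApprox
end
end
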